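/- Let κ > 0 be a killing rate with κ^{−1} ≥ 2. Then for every x ∈ ℤ² with 4 ≤ |x| ≤ 2κ^{−1}, the Green's function satisfies G^{o,o} − G^{o,x} ≥ (log |x|)/π. -/

import Mathlib

open scoped Real

/-- Graph (L¹) distance of `x ∈ ℤ²` from the origin: `|x₁| + |x₂|`. -/
def gnorm (x : ℤ × ℤ) : ℕ := x.1.natAbs + x.2.natAbs

/-- `W n x` is the number of nearest-neighbour walks of length `n` in `ℤ²`
from the origin `o = (0,0)` to `x`, i.e. the number of sequences
`(v₀, …, v_n)` with `v₀ = o`, `v_n = x` and `|v_{i+1} − v_i| = 1` for all `i`. -/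
noncomputable def W (n : ℕ) (x : ℤ × ℤ) : ℕ :=
  Set.ncard {v : Fin (n + 1) → ℤ × ℤ |
    v 0 = (0, 0) ∧ v (Fin.last n) = x ∧
    ∀ i : Fin n, gnorm (v i.succ - v i.castSucc) = 1}

/-- The Green's function `G^{o,x}` of the simple random walk on `ℤ²` with
killing rate `κ`: `G κ x = Σ_{n≥0} (4+κ)^{-n} W_n^{o,x}`. -/
noncomputable def G (κ : ℝ) (x : ℤ × ℤ) : ℝ :=
  ∑' n : ℕ, (1 / (4 + κ)) ^ n * (W n x : ℝ)

/-- One-dimensional walk counts. -/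
def cw : ℕ → ℤ → ℕ
  | 0, k => if k = 0 then 1 else 0
  | n + 1, k => cw n (k - 1) + cw n (k + 1)

/-- The set of walks. -/
def SW (n : ℕ) (x : ℤ × ℤ) : Set (Fin (n + 1) → ℤ × ℤ) :=
  {v | v 0 = (0, 0) ∧ v (Fin.last n) = x ∧
    ∀ i : Fin n, gnorm (v i.succ - v i.castSucc) = 1}

lemma gnorm_one (a : ℤ × ℤ) :
    gnorm a = 1 ↔ a = (1, 0) ∨ a = (-1, 0) ∨ a = (0, 1) ∨ a = (0, -1) := by
  obtain ⟨p, q⟩ := a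
  simp only [gnorm, Prod.mk.injEq]
  omega

lemma SW_snoc (n : ℕ) (x : ℤ × ℤ) (w : Fin (n + 1) → ℤ × ℤ) :
    (Fin.snoc w x : Fin (n + 2) → ℤ × ℤ) ∈ SW (n + 1) x ↔
      (w ∈ SW n (w (Fin.last n)) ∧ gnorm (x - w (Fin.last n)) = 1) := by
  have h0 : (Fin.snoc w x : Fin (n + 2) → ℤ × ℤ) 0 = w 0 := by
    rw [← Fin.castSucc_zero, Fin.snoc_castSucc (α := fun _ => ℤ × ℤ)]
  simp only [SW, Set.mem_ofPred_eq, h0, Fin.snoc_last, true_and]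
  rw [Fin.forall_fin_succ']
  simp only [Fin.succ_last, Fin.snoc_last, Fin.snoc_castSucc (α := fun _ => ℤ × ℤ),
    Fin.succ_castSucc, and_assoc]

lemma SW_succ (n : ℕ) (x : ℤ × ℤ) :
    SW (n + 1) x = (fun w => (Fin.snoc w x : Fin (n + 2) → ℤ × ℤ)) ''
      (((SW n (x - (1, 0)) ∪ SW n (x - (-1, 0))) ∪ SW n (x - (0, 1))) ∪ SW n (x - (0, -1))) := by
  ext v
  constructor
  · intro hv
    have hl : v (Fin.last (n + 1)) = x := hv.2.1
    have hs : (Fin.snoc (Fin.init v) x : Fin (n + 2) → ℤ × ℤ) = v := by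
      rw [← hl]; exact Fin.snoc_init_self v
    refine ⟨Fin.init v, ?_, hs⟩
    rw [← hs, SW_snoc, gnorm_one] at hv
    obtain ⟨h1, h2⟩ := hv
    have key : ∀ d : ℤ × ℤ, x - Fin.init v (Fin.last n) = d →
        (Fin.init v : Fin (n + 1) → ℤ × ℤ) ∈ SW n (x - d) := by
      intro d hd
      have : x - d = Fin.init v (Fin.last n) := by rw [← hd]; abel
      rw [this]; exact h1
    rcases h2 with h | h | h | h
    · exact Or.inl (Or.inl (Or.inl (key _ h)))
    · exact Or.inl (Or.inl (Or.inr (key _ h)))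
    · exact Or.inl (Or.inr (key _ h))
    · exact Or.inr (key _ h)
  · rintro ⟨w, hw, rfl⟩
    have key : ∀ d : ℤ × ℤ, gnorm d = 1 → w ∈ SW n (x - d) →
        (Fin.snoc w x : Fin (n + 2) → ℤ × ℤ) ∈ SW (n + 1) x := by
      intro d hd hw
      have hl : w (Fin.last n) = x - d := hw.2.1
      rw [SW_snoc, hl]
      exact ⟨hw, by simpa using hd⟩
    rcases hw with ((h | h) | h) | h
    · exact key _ (by decide) h
    · exact key _ (by decide) h
    · exact key _ (by decide) h
    · exact key _ (by decide) h

lemma SW_disj (n : ℕ) {y z : ℤ × ℤ} (h : y ≠ z) : Disjoint (SW n y) (SW n z) := by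
  rw [Set.disjoint_left]
  intro v hy hz
  exact h (hy.2.1.symm.trans hz.2.1)

lemma SW_encard (n : ℕ) : ∀ x : ℤ × ℤ,
    (SW n x).encard = ((cw n (x.1 + x.2) * cw n (x.1 - x.2) : ℕ) : ℕ∞) := by
  induction n with
  | zero =>
    rintro ⟨p, q⟩
    by_cases h : p = 0 ∧ q = 0
    · obtain ⟨rfl, rfl⟩ := h
      have : SW 0 (0, 0) = {fun _ => (0, 0)} := by
        ext v
        simp only [SW, Set.mem_ofPred_eq, Set.mem_singleton_iff]
        constructor
        · intro hv
          funext i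
          rw [show i = 0 from Fin.ext (by have := i.isLt; omega)]; exact hv.1
        · rintro rfl
          exact ⟨rfl, rfl, fun i => i.elim0⟩
      rw [this]; simp [cw]
    · have : SW 0 (p, q) = ∅ := by
        ext v
        simp only [SW, Set.mem_ofPred_eq, Set.mem_empty_iff_false, iff_false]
        rintro ⟨h1, h2, -⟩
        have h3 : v (Fin.last 0) = v 0 := rfl
        rw [h3, h1] at h2
        simp only [Prod.mk.injEq] at h2
        exact h ⟨h2.1.symm, h2.2.symm⟩
      rw [this]
      have : ¬ (p + q = 0 ∧ p - q = 0) := by omega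
      simp only [cw, Set.encard_empty]
      split_ifs <;> simp_all
  | succ n ih =>
    rintro ⟨p, q⟩
    rw [SW_succ, Function.Injective.encard_image, Set.encard_union_eq, Set.encard_union_eq,
      Set.encard_union_eq, ih, ih, ih, ih]
    · simp only [cw, Prod.mk_sub_mk]
      rw [show p - 1 + (q - 0) = p + q - 1 by ring, show p - 1 - (q - 0) = p - q - 1 by ring,
        show p - -1 + (q - 0) = p + q + 1 by ring, show p - -1 - (q - 0) = p - q + 1 by ring,
        show p - 0 + (q - 1) = p + q - 1 by ring, show p - 0 - (q - 1) = p - q + 1 by ring,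
        show p - 0 + (q - -1) = p + q + 1 by ring, show p - 0 - (q - -1) = p - q - 1 by ring]
      push_cast
      ring
    · exact SW_disj n (by simp; try omega)
    · rw [Set.disjoint_union_left]
      exact ⟨SW_disj n (by simp; try omega), SW_disj n (by simp; try omega)⟩
    · rw [Set.disjoint_union_left, Set.disjoint_union_left]
      exact ⟨⟨SW_disj n (by simp; try omega), SW_disj n (by simp; try omega)⟩, SW_disj n (by simp; try omega)⟩
    · intro a b hab
      have := congrArg (Fin.init (α := fun _ => ℤ × ℤ)) hab
      simpa using this

lemma W_eq (n : ℕ) (x : ℤ × ℤ) : W n x = cw n (x.1 + x.2) * cw n (x.1 - x.2) := by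
  have h := SW_encard n x
  have : W n x = (SW n x).encard.toNat := rfl
  rw [this, h]; rfl

lemma cw_parity (n : ℕ) : ∀ k : ℤ, (n + k) % 2 = 1 → cw n k = 0 := by
  induction n with
  | zero => intro k hk; simp only [cw]; rw [if_neg]; omega
  | succ n ih =>
    intro k hk
    simp only [cw]
    rw [ih, ih] <;> push_cast at hk <;> omega

lemma cw_far (n : ℕ) : ∀ k : ℤ, n < k.natAbs → cw n k = 0 := by
  induction n with
  | zero => intro k hk; simp only [cw]; rw [if_neg]; omega
  | succ n ih =>
    intro k hk
    simp only [cw]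
    rw [ih, ih] <;> omega

lemma cw_le (n : ℕ) : ∀ k : ℤ, cw n k ≤ 2 ^ n := by
  induction n with
  | zero => intro k; simp only [cw]; split_ifs <;> simp
  | succ n ih =>
    intro k
    simp only [cw]
    have := ih (k - 1)
    have := ih (k + 1)
    rw [pow_succ]; omega

lemma cw_choose (n : ℕ) : ∀ i : ℕ, cw n (2 * i - n) = n.choose i := by
  induction n with
  | zero =>
    intro i
    cases i with
    | zero => simp [cw]
    | succ i => simp only [cw]; rw [if_neg (by push_cast; omega)]; simp
  | succ n ih =>
    intro i
    cases i with
    | zero =>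
      simp only [cw]
      rw [cw_far n _ (by push_cast; omega)]
      have := ih 0
      rw [show (2 * ((0 : ℕ) : ℤ) - ((n + 1 : ℕ) : ℤ) + 1) = 2 * ((0 : ℕ) : ℤ) - n by
        push_cast; ring, this]
      simp
    | succ i =>
      simp only [cw]
      rw [show (2 * ((i + 1 : ℕ) : ℤ) - ((n + 1 : ℕ) : ℤ) + 1) = 2 * ((i + 1 : ℕ) : ℤ) - n by
        push_cast; ring, ih,
        show (2 * ((i + 1 : ℕ) : ℤ) - ((n + 1 : ℕ) : ℤ) - 1) = 2 * (i : ℤ) - n by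
        push_cast; ring, ih, Nat.choose_succ_succ]

lemma cw_zero (n : ℕ) : cw (2 * n) 0 = n.centralBinom := by
  have := cw_choose (2 * n) n
  rw [Nat.centralBinom, ← this]
  congr 1; push_cast; ring

lemma cw_even_le (n : ℕ) (k : ℤ) : cw (2 * n) k ≤ n.centralBinom := by
  by_cases h1 : (2 * n : ℕ) < k.natAbs
  · rw [cw_far _ _ h1]; exact Nat.zero_le _
  by_cases h2 : (((2 * n : ℕ) : ℤ) + k) % 2 = 1
  · rw [cw_parity _ _ h2]; exact Nat.zero_le _
  obtain ⟨i, hi⟩ : ∃ i : ℕ, k = 2 * (i : ℤ) - (2 * n : ℕ) :=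
    ⟨((k + 2 * n) / 2).toNat, by push_cast at *; omega⟩
  rw [hi, cw_choose]
  exact Nat.choose_le_centralBinom i n

lemma cw_odd_le (n : ℕ) (k : ℤ) : cw (2 * n + 1) k ≤ 2 * n.centralBinom := by
  simp only [cw]
  have := cw_even_le n (k - 1)
  have := cw_even_le n (k + 1)
  omega

lemma W_far (n : ℕ) (x : ℤ × ℤ) (h : n < gnorm x) : W n x = 0 := by
  rw [W_eq]
  unfold gnorm at h
  by_cases h1 : n < (x.1 + x.2).natAbs
  · rw [cw_far _ _ h1, zero_mul]
  · rw [cw_far n (x.1 - x.2) (by omega), mul_zero]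

lemma W_parity (n : ℕ) (x : ℤ × ℤ) (h : (n + gnorm x) % 2 = 1) : W n x = 0 := by
  rw [W_eq, cw_parity _ _ (by unfold gnorm at h; omega), zero_mul]

lemma W_le4 (n : ℕ) (x : ℤ × ℤ) : W n x ≤ 4 ^ n := by
  rw [W_eq, show 4 = 2 * 2 by rfl, mul_pow]
  exact Nat.mul_le_mul (cw_le _ _) (cw_le _ _)

lemma W_zero (n : ℕ) : W (2 * n) (0, 0) = n.centralBinom ^ 2 := by
  rw [W_eq]; simp [cw_zero, sq]

lemma W_even_le (n : ℕ) (x : ℤ × ℤ) : W (2 * n) x ≤ n.centralBinom ^ 2 := by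
  rw [W_eq, sq]
  exact Nat.mul_le_mul (cw_even_le _ _) (cw_even_le _ _)

lemma W_odd_le (n : ℕ) (x : ℤ × ℤ) : W (2 * n + 1) x ≤ 4 * n.centralBinom ^ 2 := by
  rw [W_eq]
  calc _ ≤ (2 * n.centralBinom) * (2 * n.centralBinom) :=
        Nat.mul_le_mul (cw_odd_le _ _) (cw_odd_le _ _)
    _ = _ := by ring

lemma G_summable (κ : ℝ) (hκ : 0 < κ) (x : ℤ × ℤ) :
    Summable (fun n : ℕ => (1 / (4 + κ)) ^ n * (W n x : ℝ)) := by
  have h : Summable (fun n : ℕ => (4 / (4 + κ)) ^ n) :=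
    summable_geometric_of_lt_one (by positivity) (by rw [div_lt_one (by positivity)]; linarith)
  refine Summable.of_nonneg_of_le (fun n => by positivity) (fun n => ?_) h
  have : (W n x : ℝ) ≤ 4 ^ n := by exact_mod_cast W_le4 n x
  calc _ ≤ (1 / (4 + κ)) ^ n * 4 ^ n := by gcongr
    _ = _ := by rw [← mul_pow]; congr 1; ring

lemma tsum_parity (f : ℕ → ℝ) (hf : Summable f) (e : ℕ) (he : e < 2)
    (h : ∀ n, (n + e) % 2 = 1 → f n = 0) : ∑' n, f n = ∑' n, f (2 * n + e) := by
  have h0 : Summable (fun n => f (2 * n)) :=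
    hf.comp_injective (i := fun n => 2 * n) (fun a b hab => by simpa using hab)
  have h1 : Summable (fun n => f (2 * n + 1)) :=
    hf.comp_injective (i := fun n => 2 * n + 1) (fun a b hab => by simpa using hab)
  rw [← tsum_even_add_odd h0 h1]
  interval_cases e
  · have : ∀ n, f (2 * n + 1) = 0 := fun n => h _ (by omega)
    simp [this]
  · have : ∀ n, f (2 * n) = 0 := fun n => h _ (by omega)
    simp [this]

lemma cb_lower (n : ℕ) :
    16 ^ n * (2 / (2 * n + 1)) / π ≤ ((n.centralBinom : ℝ)) ^ 2 := by
  have h1 := Real.Wallis.W_le n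
  rw [Real.Wallis.W_eq_factorial_ratio] at h1
  have h2 : (n.centralBinom : ℝ) = ((2 * n).factorial : ℝ) / ((n.factorial : ℝ) ^ 2) := by
    rw [Nat.centralBinom_eq_two_mul_choose, Nat.cast_choose ℝ (by omega : n ≤ 2 * n),
      show 2 * n - n = n by omega, sq]
  have hp := Real.pi_pos
  have hF : (0 : ℝ) < (2 * n).factorial := by exact_mod_cast Nat.factorial_pos _
  have hf : (0 : ℝ) < n.factorial := by exact_mod_cast Nat.factorial_pos _
  have h3 : (2 : ℝ) ^ (4 * n) = 16 ^ n := by rw [pow_mul]; norm_num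
  rw [h3, div_le_iff₀ (by positivity)] at h1
  rw [h2, div_le_iff₀ hp, div_pow, div_mul_eq_mul_div, le_div_iff₀ (by positivity),
    mul_div_assoc', div_mul_eq_mul_div, div_le_iff₀ (by positivity)]
  nlinarith [h1]

lemma log_sum (j : ℕ) : Real.log (2 * (j + 1 : ℕ) + 1) + 1 / 2 ≤
    ∑ n ∈ Finset.range (j + 1), (2 : ℝ) / (2 * n + 1) := by
  induction j with
  | zero =>
    simp only [zero_add, Finset.range_one, Finset.sum_singleton]
    have he := Real.exp_one_gt_d9
    have h : Real.log 3 ≤ 3 / 2 := by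
      have h1 := Real.log_le_sub_one_of_pos (x := 3 / Real.exp 1) (by positivity)
      rw [Real.log_div (by norm_num) (by positivity), Real.log_exp] at h1
      have h2 : 3 / Real.exp 1 ≤ 3 / 2 := by gcongr; linarith
      linarith
    norm_num
    linarith
  | succ j ih =>
    rw [Finset.sum_range_succ]
    have h1 := Real.log_le_sub_one_of_pos
      (x := (2 * ((j + 1 + 1 : ℕ) : ℝ) + 1) / (2 * (j + 1 : ℕ) + 1)) (by positivity)
    rw [Real.log_div (by positivity) (by positivity)] at h1
    have h2 : (2 * ((j + 1 + 1 : ℕ) : ℝ) + 1) / (2 * (j + 1 : ℕ) + 1) - 1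
        = 2 / (2 * (j + 1 : ℕ) + 1) := by
      rw [div_sub_one (by positivity)]; congr 1; push_cast; ring
    rw [h2] at h1
    linarith

lemma term_lower (κ : ℝ) (hκ : 0 < κ) (j n : ℕ) (hj : 0 < j) (hk : κ * j ≤ 1) :
    (2 / (2 * n + 1) - 1 / (2 * j)) / π ≤
      (1 / (4 + κ)) ^ (2 * n) * (n.centralBinom : ℝ) ^ 2 := by
  have hp := Real.pi_pos
  have hj' : (0 : ℝ) < j := by exact_mod_cast hj
  have hb := cb_lower n
  have hlam : 4 / (4 + κ) = 1 + (-(κ / (4 + κ))) := by field_simp; ring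
  have hle : κ / (4 + κ) ≤ 1 / (4 * j) := by
    rw [div_le_div_iff₀ (by positivity) (by positivity)]; nlinarith
  have hle1 : κ / (4 + κ) ≤ 1 := by rw [div_le_one (by positivity)]; linarith
  have hB := one_add_mul_le_pow (a := -(κ / (4 + κ))) (by linarith) (2 * n)
  rw [← hlam] at hB
  have hB2 : 1 - n / (2 * j) ≤ (4 / (4 + κ)) ^ (2 * n) := by
    refine le_trans ?_ hB
    have : (n : ℝ) / (2 * j) = (2 * n) * (1 / (4 * j)) := by field_simp; ring
    rw [this]; push_cast
    nlinarith [mul_le_mul_of_nonneg_left hle (by positivity : (0 : ℝ) ≤ 2 * n)]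
  calc (2 / (2 * n + 1) - 1 / (2 * j)) / π
      ≤ ((1 - n / (2 * j)) * (2 / (2 * n + 1))) / π := by
        gcongr
        have : (n : ℝ) / (2 * j) * (2 / (2 * n + 1)) ≤ 1 / (2 * j) := by
          rw [div_mul_div_comm, div_le_div_iff₀ (by positivity) (by positivity)]
          nlinarith
        linarith
    _ ≤ ((4 / (4 + κ)) ^ (2 * n) * (2 / (2 * n + 1))) / π := by gcongr
    _ = (1 / (4 + κ)) ^ (2 * n) * (16 ^ n * (2 / (2 * n + 1)) / π) := by
        rw [show (16 : ℝ) ^ n = 4 ^ (2 * n) by rw [pow_mul]; norm_num, div_pow, div_pow]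
        ring
    _ ≤ _ := by gcongr

/-- Proposition 3.3, eq. (3.9): if `κ⁻¹ ≥ 2` and `4 ≤ |x| ≤ 2κ⁻¹`, then
`G^{o,o} − G^{o,x} ≥ (log |x|)/π`. -/
theorem stmt5 (κ : ℝ) (hκ : 0 < κ) (hκ' : 2 ≤ κ⁻¹)
    (x : ℤ × ℤ) (hx : 4 ≤ gnorm x) (hx' : (gnorm x : ℝ) ≤ 2 * κ⁻¹) :
    Real.log (gnorm x) / π ≤ G κ (0, 0) - G κ x := by
  obtain ⟨j, e, he, hm⟩ : ∃ j e : ℕ, e < 2 ∧ gnorm x = 2 * j + e :=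
    ⟨gnorm x / 2, gnorm x % 2, by omega, by omega⟩
  have hj : 0 < j := by omega
  have hj' : (0 : ℝ) < j := by exact_mod_cast hj
  have hp := Real.pi_pos
  have hk : κ * j ≤ 1 := by
    have h1 : (2 * j : ℝ) ≤ gnorm x := by rw [hm]; push_cast; linarith [Nat.cast_nonneg (α := ℝ) e]
    have h2 : (j : ℝ) ≤ κ⁻¹ := by linarith
    calc κ * j ≤ κ * κ⁻¹ := by gcongr
      _ = 1 := mul_inv_cancel₀ hκ.ne'
  have s0 := G_summable κ hκ (0, 0)
  have sx := G_summable κ hκ x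
  have g0 : G κ (0, 0) = ∑' n : ℕ, (1 / (4 + κ)) ^ (2 * n) * ((n.centralBinom : ℝ)) ^ 2 := by
    unfold G
    rw [tsum_parity _ s0 0 (by norm_num)]
    · refine tsum_congr fun n => ?_
      rw [add_zero, W_zero]; push_cast; rfl
    · intro n hn
      rw [W_parity n (0, 0) (by simpa [gnorm] using hn)]; simp
  have gx : G κ x = ∑' n : ℕ, (1 / (4 + κ)) ^ (2 * n + e) * (W (2 * n + e) x : ℝ) := by
    unfold G
    rw [tsum_parity _ sx e he]
    intro n hn
    rw [W_parity n x (by omega)]; simp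
  have s0' : Summable fun n : ℕ => (1 / (4 + κ)) ^ (2 * n) * ((n.centralBinom : ℝ)) ^ 2 := by
    have := s0.comp_injective (i := fun n => 2 * n) (fun a b hab => by simpa using hab)
    refine this.congr fun n => ?_
    simp [W_zero]
  have sx' : Summable fun n : ℕ => (1 / (4 + κ)) ^ (2 * n + e) * (W (2 * n + e) x : ℝ) :=
    sx.comp_injective (i := fun n => 2 * n + e) (fun a b hab => by simpa using hab)
  have hle : ∀ n : ℕ, (1 / (4 + κ)) ^ (2 * n + e) * (W (2 * n + e) x : ℝ) ≤
      (1 / (4 + κ)) ^ (2 * n) * ((n.centralBinom : ℝ)) ^ 2 := by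
    intro n
    rw [pow_add, mul_assoc]
    refine mul_le_mul_of_nonneg_left ?_ (by positivity)
    interval_cases e
    · have : (W (2 * n) x : ℝ) ≤ (n.centralBinom : ℝ) ^ 2 := by exact_mod_cast W_even_le n x
      simpa using this
    · have : (W (2 * n + 1) x : ℝ) ≤ 4 * (n.centralBinom : ℝ) ^ 2 := by
        exact_mod_cast W_odd_le n x
      rw [pow_one, one_div_mul_eq_div, div_le_iff₀ (by positivity)]
      nlinarith [mul_nonneg hκ.le (sq_nonneg (n.centralBinom : ℝ))]
  rw [g0, gx, ← s0'.tsum_sub sx']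
  refine le_trans ?_ ((s0'.sub sx').sum_le_tsum (Finset.range j)
    (fun n _ => sub_nonneg.2 (hle n)))
  have hfin : ∑ n ∈ Finset.range j, (2 / (2 * n + 1) - 1 / (2 * j)) / π ≤
      ∑ n ∈ Finset.range j, ((1 / (4 + κ)) ^ (2 * n) * ((n.centralBinom : ℝ)) ^ 2 -
        (1 / (4 + κ)) ^ (2 * n + e) * (W (2 * n + e) x : ℝ)) := by
    refine Finset.sum_le_sum fun n hn => ?_
    rw [Finset.mem_range] at hn
    rw [W_far (2 * n + e) x (by omega), Nat.cast_zero, mul_zero, sub_zero]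
    exact term_lower κ hκ j n hj hk
  refine le_trans ?_ hfin
  rw [← Finset.sum_div, Finset.sum_sub_distrib, Finset.sum_const, Finset.card_range, nsmul_eq_mul]
  have hc : (j : ℝ) * (1 / (2 * j)) = 1 / 2 := by field_simp
  rw [hc]
  gcongr
  obtain ⟨i, rfl⟩ : ∃ i, j = i + 1 := ⟨j - 1, by omega⟩
  have h1 := log_sum i
  have h2 : Real.log (gnorm x) ≤ Real.log (2 * (i + 1 : ℕ) + 1) := by
    apply Real.log_le_log
    · exact_mod_cast (by omega : 0 < gnorm x)
    · exact_mod_cast (by omega : gnorm x ≤ 2 * (i + 1) + 1)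
  linarith
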